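/- Let a group G act without inversion on locally finite pocsets P and P', and let f : P → P' be a G-equivariant resolution. Suppose that G has only finitely many orbits on P, and that for every hyperplane ĥ' of P' the stabilizer Stab_G(ĥ') = {g ∈ G : g·h' = h'} is a finitely generated group. Then there exists a finite folding sequence P = P₀ ↝ P₁ ↝ ⋯ ↝ Pₙ for f such that Pₙ is isomorphic as a G-pocset to P/∼_f and the induced map Pₙ → P' is an embedding of pocsets, so that f factors as the composition of the folds followed by this embedding. -/

import Mathlib

/- Pocsets, hyperplanes, admissible equivalence relations, quotients,
   admissible maps, embeddings, resolutions, group actions on pocsets,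
   elementary folds and folding sequences. -/

universe u v w

/-- A pocset: a poset with an order-reversing involution `star` such that
`h ≠ h *` and `h`, `h *` are incomparable. -/
structure Pocset (P : Type u) where
  le : P → P → Prop
  star : P → P
  le_refl : ∀ a, le a a
  le_trans : ∀ {a b c}, le a b → le b c → le a c
  le_antisymm : ∀ {a b}, le a b → le b a → a = b
  star_star : ∀ a, star (star a) = a
  star_antitone : ∀ {a b}, le a b → le (star b) (star a)
  ne_star : ∀ a, a ≠ star a
  not_le_star : ∀ a, ¬ le a (star a)
  not_star_le : ∀ a, ¬ le (star a) a

namespace Pocset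

variable {P : Type u} {P' : Type v}

/-- Strict order. -/
def lt (Q : Pocset P) (a b : P) : Prop := Q.le a b ∧ a ≠ b

/-- The orientations of the hyperplane `ĥ` determined by the halfspace `h`. -/
def orient (Q : Pocset P) (h : P) : Set P := {h, Q.star h}

/-- `k` is an orientation of the same hyperplane as `h`, i.e. `k̂ = ĥ`. -/
def sameHyp (Q : Pocset P) (h k : P) : Prop := k = h ∨ k = Q.star h

/-- The hyperplanes `ĥ` and `k̂` are transverse: they are distinct and no
orientation of `ĥ` is comparable with any orientation of `k̂`. -/
def transverse (Q : Pocset P) (h k : P) : Prop :=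
  ¬ Q.sameHyp h k ∧ ∀ a ∈ Q.orient h, ∀ b ∈ Q.orient k, ¬ Q.le a b ∧ ¬ Q.le b a

/-- Two hyperplanes are disjoint if they are distinct and not transverse. -/
def disjointHyp (Q : Pocset P) (h k : P) : Prop :=
  ¬ Q.sameHyp h k ∧ ¬ Q.transverse h k

/-- The halfspaces `h` and `k` are facing: `h* < k`. -/
def facing (Q : Pocset P) (h k : P) : Prop := Q.lt (Q.star h) k

/-- The halfspaces `h` and `k` are compatible: not `k ≤ h*`. -/
def compatible (Q : Pocset P) (h k : P) : Prop := ¬ Q.le k (Q.star h)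

/-- The hyperplane `k̂` separates the hyperplanes `ĥ` and `l̂`: there are
orientations with `a < b < c`. -/
def separates (Q : Pocset P) (k h l : P) : Prop :=
  ∃ a ∈ Q.orient h, ∃ b ∈ Q.orient k, ∃ c ∈ Q.orient l, Q.lt a b ∧ Q.lt b c

/-- Local finiteness: every interval is finite. -/
def LocallyFinite (Q : Pocset P) : Prop :=
  ∀ a b : P, {c : P | Q.le a c ∧ Q.le c b}.Finite

/-- The equivalence relation induced on hyperplanes by a relation `r` on
halfspaces: `ĥ ∼ k̂` iff `h ∼ k` or `h ∼ k*`. -/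
def hypRel (Q : Pocset P) (r : P → P → Prop) (h k : P) : Prop :=
  r h k ∨ r h (Q.star k)

/-- An admissible equivalence relation on a pocset. -/
structure IsAdmissible (Q : Pocset P) (r : P → P → Prop) : Prop where
  equiv : Equivalence r
  aer1 : ∀ h, ¬ r h (Q.star h)
  aer2 : ∀ h k, r h k → r (Q.star h) (Q.star k)
  aer3 : ∀ h k, Q.transverse h k → ¬ r h k
  aer4 : ∀ h k, Q.hypRel r h k → ¬ Q.sameHyp h k →
    (∀ m, Q.hypRel r h m → ¬ Q.separates m h k) →
    ∀ a ∈ Q.orient h, ∀ b ∈ Q.orient k, Q.facing a b → r a b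

/-- The strict quotient relation: `[h] < [k]` iff `[h] ≠ [k]`, every pair of
representatives has disjoint hyperplanes, and `h' < k'` for every pair of
representatives whose hyperplanes are `([ĥ] ∪ [k̂])`-inseparable. -/
def QuotLT (Q : Pocset P) (r : P → P → Prop) (h k : P) : Prop :=
  ¬ r h k ∧
  (∀ h' k', r h h' → r k k' → Q.disjointHyp h' k') ∧
  (∀ h' k', r h h' → r k k' →
    (∀ m, (Q.hypRel r h m ∨ Q.hypRel r k m) → ¬ Q.separates m h' k') → Q.lt h' k')

/-- The quotient relation: `[h] ≤ [k]` iff `[h] = [k]` or `[h] < [k]`. -/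
def QuotLE (Q : Pocset P) (r : P → P → Prop) (h k : P) : Prop :=
  r h k ∨ Q.QuotLT r h k

/-- Transversality of `[ĥ]` and `[k̂]` in the quotient pocset. -/
def QuotTransverse (Q : Pocset P) (r : P → P → Prop) (h k : P) : Prop :=
  ¬ Q.hypRel r h k ∧
  ∀ a ∈ Q.orient h, ∀ b ∈ Q.orient k, ¬ Q.QuotLE r a b ∧ ¬ Q.QuotLE r b a

/-- `[k̂]` separates `[ĥ]` and `[l̂]` in the quotient pocset. -/
def QuotSeparates (Q : Pocset P) (r : P → P → Prop) (k h l : P) : Prop :=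
  ∃ a ∈ Q.orient h, ∃ b ∈ Q.orient k, ∃ c ∈ Q.orient l,
    Q.QuotLT r a b ∧ Q.QuotLT r b c

/-- `[h]` and `[k]` are facing in the quotient pocset: `[h]* < [k]`. -/
def QuotFacing (Q : Pocset P) (r : P → P → Prop) (h k : P) : Prop :=
  Q.QuotLT r (Q.star h) k

/-- An admissible map of pocsets. -/
structure IsAdmissibleMap (Q : Pocset P) (Q' : Pocset P') (f : P → P') : Prop where
  am1 : ∀ h, f (Q.star h) = Q'.star (f h)
  am2 : ∀ h k, Q.transverse h k → Q'.transverse (f h) (f k)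
  am3 : ∀ h k, Q.facing h k → Q'.sameHyp (f h) (f k) →
    (∀ m, Q'.sameHyp (f m) (f h) → ¬ Q.separates m h k) → f h = f k
  am4 : ∀ h' : P', (∀ m : P, ¬ Q'.sameHyp (f m) h') →
    ∃ b ∈ Q'.orient h', ∀ m : P, Q'.compatible b (f m)

/-- An embedding of pocsets: an injective, order-reflecting admissible map. -/
structure IsPocsetEmbedding (Q : Pocset P) (Q' : Pocset P') (f : P → P') : Prop where
  adm : IsAdmissibleMap Q Q' f
  inj : Function.Injective f
  le_reflect : ∀ h k, Q'.le (f h) (f k) → Q.le h k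

/-- The equivalence relation `∼_f` induced by a map `f`. -/
def simRel (f : P → P') : P → P → Prop := fun a b => f a = f b

/-- A resolution of pocsets: an admissible map `f` such that `∼_f` is an
admissible equivalence relation and the induced map `P/∼_f → P'` is an
embedding of pocsets (stated here on representatives: `quot_am2` and
`quot_am3` are admissibility of the induced map, `le_reflect` is
order-reflection; injectivity of the induced map is automatic, and its
properties (AM1) and (AM4) coincide with those of `f`). -/
structure IsResolution (Q : Pocset P) (Q' : Pocset P') (f : P → P') : Prop where
  adm : IsAdmissibleMap Q Q' f
  aer : Q.IsAdmissible (simRel f)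
  quot_am2 : ∀ h k, Q.QuotTransverse (simRel f) h k → Q'.transverse (f h) (f k)
  quot_am3 : ∀ h k, Q.QuotFacing (simRel f) h k → Q'.sameHyp (f h) (f k) →
    (∀ m, Q'.sameHyp (f m) (f h) → ¬ Q.QuotSeparates (simRel f) m h k) → f h = f k
  le_reflect : ∀ h k, Q'.le (f h) (f k) → Q.QuotLE (simRel f) h k

/-- A group `G` acts (without inversion) on the pocset `Q` by order-preserving
bijections commuting with `star`. -/
structure IsGAction (Q : Pocset P) (G : Type w) [Group G] [MulAction G P] : Prop where
  smul_le : ∀ (g : G) (a b : P), Q.le a b → Q.le (g • a) (g • b)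
  smul_star : ∀ (g : G) (a : P), g • Q.star a = Q.star (g • a)
  no_inversion : ∀ (g : G) (a : P), g • a ≠ Q.star a

/-- `G`-equivariance of a map. -/
def Equivariant (G : Type w) [Group G] [MulAction G P] [MulAction G P']
    (f : P → P') : Prop :=
  ∀ (g : G) (a : P), f (g • a) = g • f a

/-- An elementary foldable pair for a resolution `f`: facing halfspaces with
`f h₁ = f h₂`, whose hyperplanes are `f⁻¹(f(ĥ₁))`-inseparable, such that no
pair of distinct `∼_f`-equivalent hyperplanes both separate `ĥ₁` and `ĥ₂`. -/
def ElemFoldable (Q : Pocset P) (Q' : Pocset P') (f : P → P') (h₁ h₂ : P) : Prop :=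
  Q.facing h₁ h₂ ∧ f h₁ = f h₂ ∧
  (∀ m, Q'.sameHyp (f m) (f h₁) → ¬ Q.separates m h₁ h₂) ∧
  (∀ m m', Q'.sameHyp (f m) (f m') → ¬ Q.sameHyp m m' →
    ¬ (Q.separates m h₁ h₂ ∧ Q.separates m' h₁ h₂))

/-- `r` is the smallest `G`-invariant and `star`-invariant equivalence
relation with `h₁ ∼ h₂`. -/
structure IsFoldRel (Q : Pocset P) (G : Type w) [Group G] [MulAction G P]
    (h₁ h₂ : P) (r : P → P → Prop) : Prop where
  equiv : Equivalence r
  ginv : ∀ (g : G) (a b : P), r a b → r (g • a) (g • b)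
  sinv : ∀ a b, r a b → r (Q.star a) (Q.star b)
  base : r h₁ h₂
  min : ∀ s : P → P → Prop, Equivalence s →
    (∀ (g : G) (a b : P), s a b → s (g • a) (g • b)) →
    (∀ a b, s a b → s (Q.star a) (Q.star b)) → s h₁ h₂ →
    ∀ a b, r a b → s a b

/-- `[h₁]`, `[h₂]` is an elementary foldable pair in the quotient pocset
`P/r` for the resolution induced by `f` on `P/r`. -/
def QuotElemFoldable (Q : Pocset P) (Q' : Pocset P') (f : P → P')
    (r : P → P → Prop) (h₁ h₂ : P) : Prop :=
  Q.QuotFacing r h₁ h₂ ∧ f h₁ = f h₂ ∧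
  (∀ m, Q'.sameHyp (f m) (f h₁) → ¬ Q.QuotSeparates r m h₁ h₂) ∧
  (∀ m m', Q'.sameHyp (f m) (f m') → ¬ Q.hypRel r m m' →
    ¬ (Q.QuotSeparates r m h₁ h₂ ∧ Q.QuotSeparates r m' h₁ h₂))

/-- `r'` is (the pullback to `P` of) the smallest `G`-invariant and
`star`-invariant equivalence relation on `P/r` identifying `[h₁] ∼ [h₂]`,
i.e. the smallest `G`-invariant, `star`-invariant equivalence relation on `P`
containing `r` with `h₁ ∼ h₂`. -/
structure IsFoldStepRel (Q : Pocset P) (G : Type w) [Group G] [MulAction G P]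
    (r : P → P → Prop) (h₁ h₂ : P) (r' : P → P → Prop) : Prop where
  equiv : Equivalence r'
  mono : ∀ a b, r a b → r' a b
  ginv : ∀ (g : G) (a b : P), r' a b → r' (g • a) (g • b)
  sinv : ∀ a b, r' a b → r' (Q.star a) (Q.star b)
  base : r' h₁ h₂
  min : ∀ s : P → P → Prop, Equivalence s → (∀ a b, r a b → s a b) →
    (∀ (g : G) (a b : P), s a b → s (g • a) (g • b)) →
    (∀ a b, s a b → s (Q.star a) (Q.star b)) → s h₁ h₂ →
    ∀ a b, r' a b → s a b

/-- A finite folding sequence `P = P₀ ↝ P₁ ↝ ⋯ ↝ Pₙ` for a `G`-equivariant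
resolution `f : P → P'`, encoded by the sequence of equivalence relations
`rs i` on `P` with `Pᵢ = P / rs i`: `rs 0` is equality, every `rs i` refines
`∼_f`, and each step is an elementary fold (of an elementary foldable pair
for the induced resolution `fᵢ : P/rs i → P'`). -/
def IsFoldingSequence (Q : Pocset P) (Q' : Pocset P') (G : Type w) [Group G]
    [MulAction G P] (f : P → P') (n : ℕ)
    (rs : Fin (n + 1) → (P → P → Prop)) : Prop :=
  (∀ a b : P, rs 0 a b ↔ a = b) ∧
  (∀ (i : Fin (n + 1)) (a b : P), rs i a b → f a = f b) ∧
  (∀ i : Fin n, ∃ h₁ h₂ : P,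
    Q.QuotElemFoldable Q' f (rs i.castSucc) h₁ h₂ ∧
    Q.IsFoldStepRel G (rs i.castSucc) h₁ h₂ (rs i.succ))

end Pocset

namespace Pocset

variable {P : Type u} {P' : Type v}

section Order

variable (Q : Pocset P)

theorem lt_trans {a b c : P} (h : Q.lt a b) (k : Q.lt b c) : Q.lt a c :=
  ⟨Q.le_trans h.1 k.1, fun e => h.2 (Q.le_antisymm h.1 (e ▸ k.1))⟩

theorem star_lt_star {a b : P} (h : Q.lt a b) : Q.lt (Q.star b) (Q.star a) :=
  ⟨Q.star_antitone h.1, fun e => h.2 (by rw [← Q.star_star a, ← e, Q.star_star])⟩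

theorem not_lt_self (a : P) : ¬ Q.lt a a := fun h => h.2 rfl

theorem not_lt_star (a : P) : ¬ Q.lt a (Q.star a) := fun h => Q.not_le_star a h.1

theorem not_star_lt (a : P) : ¬ Q.lt (Q.star a) a := fun h => Q.not_star_le a h.1

/-- The hyperplane of `x` is contained in the halfspace `a`. -/
def Inside (x a : P) : Prop := Q.lt x a ∨ Q.lt (Q.star x) a

theorem inside_disjoint {x a : P} (h : Q.Inside x a) (h' : Q.Inside x (Q.star a)) : False := by
  have := Q.star_star
  have := @lt_trans _ Q
  have := @star_lt_star _ Q
  have := Q.not_lt_star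
  have := Q.not_star_lt
  have := Q.not_lt_self
  unfold Inside at *
  grind

theorem not_inside_self {x : P} (h : Q.Inside x x) : False := by
  rcases h with h | h
  · exact Q.not_lt_self _ h
  · exact Q.not_star_lt _ h

theorem not_inside_star_self {x : P} (h : Q.Inside x (Q.star x)) : False := by
  rcases h with h | h
  · exact Q.not_lt_star _ h
  · exact Q.not_lt_self _ h

theorem inside_star_left {x a : P} : Q.Inside (Q.star x) a ↔ Q.Inside x a := by
  unfold Inside
  rw [Q.star_star, or_comm]

theorem separates_iff {m x y : P} : Q.separates m x y ↔
    (Q.Inside x m ∧ Q.Inside y (Q.star m)) ∨ (Q.Inside x (Q.star m) ∧ Q.Inside y m) := by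
  have := Q.star_star
  have := @star_lt_star _ Q
  unfold separates Inside orient
  constructor
  · rintro ⟨a, ha, b, hb, c, hc, h1, h2⟩
    simp only [Set.mem_insert_iff, Set.mem_singleton_iff] at ha hb hc
    grind
  · simp only [Set.mem_insert_iff, Set.mem_singleton_iff]
    rintro (⟨h1 | h1, h2 | h2⟩ | ⟨h1 | h1, h2 | h2⟩)
    all_goals
      refine ⟨_, ?_, _, ?_, _, ?_, h1, by simpa [Q.star_star] using Q.star_lt_star h2⟩ <;>
        simp

theorem separates_symm {m x y : P} (h : Q.separates m x y) : Q.separates m y x := by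
  rw [separates_iff] at *
  tauto

theorem not_separates_self {m x : P} : ¬ Q.separates m x x := by
  rw [separates_iff]
  rintro (h | h)
  · exact Q.inside_disjoint h.1 h.2
  · exact Q.inside_disjoint h.2 h.1

theorem not_separates_left {m y : P} : ¬ Q.separates m m y := by
  rw [separates_iff]
  rintro (h | h)
  · exact Q.not_inside_self h.1
  · exact Q.not_inside_star_self h.1

theorem separates_star_left {m x y : P} : Q.separates (Q.star m) x y ↔ Q.separates m x y := by
  rw [separates_iff, separates_iff, Q.star_star]
  tauto

theorem separates_star_mid {m x y : P} : Q.separates m (Q.star x) y ↔ Q.separates m x y := by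
  rw [separates_iff, separates_iff, inside_star_left, inside_star_left]

theorem separates_star_right {m x y : P} : Q.separates m x (Q.star y) ↔ Q.separates m x y := by
  rw [separates_iff, separates_iff, inside_star_left, inside_star_left]

/-- The hyperplanes of `x` and `y` are disjoint, expressed through containment in halfspaces. -/
def Nested (x y : P) : Prop := Q.Inside x y ∨ Q.Inside x (Q.star y)

theorem disjointHyp.nested {Q : Pocset P} {x y : P} (h : Q.disjointHyp x y) : Q.Nested x y := by
  have := Q.star_star
  have := @star_lt_star _ Q
  obtain ⟨h1, h2⟩ := h
  unfold transverse at h2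
  by_contra hn
  refine h2 ⟨h1, ?_⟩
  unfold Nested Inside lt sameHyp orient at *
  simp only [Set.mem_insert_iff, Set.mem_singleton_iff]
  have := @Q.star_antitone
  grind

theorem Nested.symm {Q : Pocset P} {x y : P} (h : Q.Nested x y) : Q.Nested y x := by
  have := Q.star_star
  have := @star_lt_star _ Q
  unfold Nested Inside at *
  grind

/-- A hyperplane separating `x` from `z` also separates one of them from any third hyperplane
disjoint from it. -/
theorem separates_split {m x y z : P} (h : Q.separates m x z) (hy : Q.Nested y m) :
    Q.separates m x y ∨ Q.separates m y z := by
  rw [separates_iff] at *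
  rw [separates_iff]
  unfold Nested at hy
  tauto

theorem inside_of_separates {k x m : P} (h : Q.separates k x m) (hk : Q.Inside k m) :
    Q.Inside x m := by
  have := Q.star_star
  have := @lt_trans _ Q
  have := @star_lt_star _ Q
  have := Q.not_lt_star
  have := Q.not_star_lt
  have := Q.not_lt_self
  rw [separates_iff] at h
  unfold Inside at *
  grind

theorem separates_trans {k m x y : P} (hk : Q.separates k x y) (hm : Q.separates m k y) :
    Q.separates m x y := by
  have h1 : ∀ {M : P}, Q.Inside k M → Q.Inside y (Q.star M) → Q.Inside x M := by
    intro M h1 h2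
    have := Q.star_star
    have := @lt_trans _ Q
    have := @star_lt_star _ Q
    have := Q.not_lt_star
    have := Q.not_star_lt
    have := Q.not_lt_self
    rw [separates_iff] at hk
    unfold Inside at *
    grind
  rw [separates_iff] at hm ⊢
  rcases hm with ⟨h, h'⟩ | ⟨h, h'⟩
  · exact Or.inl ⟨h1 h h', h'⟩
  · exact Or.inr ⟨h1 h (by rwa [Q.star_star]), h'⟩

theorem separates_of_lt {x m y : P} (h : Q.lt x m) (k : Q.lt m y) : Q.separates m x y :=
  ⟨x, Or.inl rfl, m, Or.inl rfl, y, Or.inl rfl, h, k⟩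

/-- A hyperplane separating `x < y` has an orientation strictly between them. -/
theorem exists_between {x m y : P} (hxy : Q.lt x y) (h : Q.separates m x y) :
    ∃ z ∈ Q.orient m, Q.lt x z ∧ Q.lt z y := by
  have h1 := Q.star_star
  have h2 := @lt_trans _ Q
  have h3 := @star_lt_star _ Q
  have h4 := Q.not_lt_star
  have h5 := Q.not_star_lt
  have h6 := Q.not_lt_self
  have key : ∀ M, Q.Inside x M → Q.Inside y (Q.star M) → Q.lt x M ∧ Q.lt M y := by
    intro M h h'
    unfold Inside at *
    grind
  rw [separates_iff] at h
  rcases h with ⟨h, h'⟩ | ⟨h, h'⟩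
  · exact ⟨m, Or.inl rfl, key m h h'⟩
  · exact ⟨Q.star m, Or.inr rfl, key _ h (by rwa [Q.star_star])⟩

variable {Q}

theorem LocallyFinite.separators (hLF : Q.LocallyFinite) (x y : P) :
    {m | Q.separates m x y}.Finite := by
  have key : ∀ a b : P, {m | Q.lt a m ∧ Q.lt m b}.Finite := fun a b =>
    (hLF a b).subset fun m hm => ⟨hm.1.1, hm.2.1⟩
  have key' : ∀ a b : P, {m | Q.lt a (Q.star m) ∧ Q.lt (Q.star m) b}.Finite := fun a b =>
    (key (Q.star b) (Q.star a)).subset fun m hm =>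
      ⟨by simpa [Q.star_star] using Q.star_lt_star hm.2,
        by simpa [Q.star_star] using Q.star_lt_star hm.1⟩
  have fin : ∀ z : P, (Q.orient z).Finite := fun z => (Set.finite_singleton (Q.star z)).insert z
  refine ((fin x).biUnion fun a _ => (fin y).biUnion fun b _ =>
    (key a b).union (key' a b)).subset ?_
  rintro m ⟨a, ha, b, hb, c, hc, hlt⟩
  simp only [Set.mem_iUnion]
  refine ⟨a, ha, c, hc, ?_⟩
  rcases hb with rfl | rfl
  · exact Or.inl hlt
  · exact Or.inr hlt

/-- Among the members of `S` there is one closest to `x` in the direction of `y`. -/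
theorem LocallyFinite.exists_closest (hLF : Q.LocallyFinite) (S : P → Prop) (x : P) :
    ∀ y, S y → ∃ z, S z ∧ (z = y ∨ Q.separates z y x) ∧ ∀ m, S m → ¬ Q.separates m z x := by
  intro y
  induction hn : {m | Q.separates m y x}.ncard using Nat.strong_induction_on generalizing y with
  | _ n ih =>
    intro hy
    by_cases h : ∃ m, S m ∧ Q.separates m y x
    · obtain ⟨m, hm, hs⟩ := h
      have hlt : {k | Q.separates k m x}.ncard < n := by
        rw [← hn]
        refine Set.ncard_lt_ncard ⟨fun k hk => Q.separates_trans hs hk, fun hsub => ?_⟩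
          (hLF.separators y x)
        exact Q.not_separates_left (hsub hs)
      obtain ⟨z, hz, hz', hmin⟩ := ih _ hlt m rfl hm
      refine ⟨z, hz, Or.inr ?_, hmin⟩
      rcases hz' with rfl | hz'
      · exact hs
      · exact Q.separates_trans hs hz'
    · push Not at h
      exact ⟨y, hy, Or.inl rfl, h⟩

end Order

section Relations

variable {Q : Pocset P}

/-- Equivalence relations compatible with the involution. -/
structure IsStarEquiv (Q : Pocset P) (r : P → P → Prop) : Prop where
  equiv : Equivalence r
  star : ∀ a b, r a b → r (Q.star a) (Q.star b)

theorem IsAdmissible.isStarEquiv {r : P → P → Prop} (h : Q.IsAdmissible r) : Q.IsStarEquiv r :=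
  ⟨h.equiv, h.aer2⟩

namespace IsStarEquiv

variable {r : P → P → Prop} (hr : Q.IsStarEquiv r)
include hr

theorem hypRel_refl (a : P) : Q.hypRel r a a := Or.inl (hr.equiv.refl a)

omit hr in
theorem hypRel_star_right {a b : P} : Q.hypRel r a (Q.star b) ↔ Q.hypRel r a b := by
  unfold hypRel
  rw [Q.star_star, or_comm]

theorem hypRel_symm {a b : P} (h : Q.hypRel r a b) : Q.hypRel r b a := by
  rcases h with h | h
  · exact Or.inl (hr.equiv.symm h)
  · refine Or.inr (hr.equiv.symm ?_)
    simpa [Q.star_star] using hr.star _ _ h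

theorem hypRel_trans {a b c : P} (h : Q.hypRel r a b) (h' : Q.hypRel r b c) :
    Q.hypRel r a c := by
  rcases h with h | h
  · exact h'.imp (hr.equiv.trans h) (hr.equiv.trans h)
  · rcases h' with h' | h'
    · exact Or.inr (hr.equiv.trans h (hr.star _ _ h'))
    · refine Or.inl (hr.equiv.trans h ?_)
      simpa [Q.star_star] using hr.star _ _ h'

theorem hypRel_of_sameHyp {a b : P} (h : Q.sameHyp a b) : Q.hypRel r a b := by
  rcases h with rfl | rfl
  · exact hr.hypRel_refl _
  · exact hypRel_star_right.2 (hr.hypRel_refl _)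

end IsStarEquiv

/-- A separating class of the quotient has a representative that separates. -/
theorem exists_separates_of_quotLT (hLF : Q.LocallyFinite) {r : P → P → Prop}
    (hr : Q.IsStarEquiv r) {h m k : P} (hm : Q.QuotLT r h m) (mk : Q.QuotLT r m k) :
    ∃ m', Q.hypRel r m m' ∧ Q.separates m' h k := by
  by_contra! hno
  obtain ⟨m₁, hm₁, -, hclose⟩ :=
    hLF.exists_closest (fun z => r m z) h m (hr.equiv.refl m)
  have hclose' : ∀ z, Q.hypRel r m z → ¬ Q.separates z m₁ h := by
    rintro z (hz | hz) hs
    · exact hclose z hz hs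
    · exact hclose _ hz (Q.separates_star_left.2 hs)
  have hh : Q.Inside h m₁ := by
    obtain ⟨h', hh', hsep, hmin⟩ :=
      hLF.exists_closest (fun z => r h z) m₁ h (hr.equiv.refl h)
    have hlt : Q.lt h' m₁ := by
      refine hm.2.2 h' m₁ hh' hm₁ ?_
      rintro z ((hz | hz) | hz) hs
      · exact hmin z hz hs
      · exact hmin _ hz (Q.separates_star_left.2 hs)
      · refine hclose' z hz (Q.separates_symm ?_)
        rcases hsep with rfl | hsep
        · exact hs
        · exact Q.separates_trans hsep hs
    rcases hsep with rfl | hsep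
    · exact Or.inl hlt
    · exact Q.inside_of_separates hsep (Or.inl hlt)
  have hcloseK : ∀ z, Q.hypRel r m z → ¬ Q.separates z m₁ k := by
    intro z hz hs
    have hn : Q.Nested h z := by
      rcases hz with hz' | hz'
      · exact (hm.2.1 h z (hr.equiv.refl h) hz').nested
      · have := (hm.2.1 h _ (hr.equiv.refl h) hz').nested
        unfold Nested at *
        rw [Q.star_star] at this
        exact this.symm
    rcases Q.separates_split hs hn with hs | hs
    · exact hclose' z hz hs
    · exact hno z hz hs
  have hk : Q.Inside k (Q.star m₁) := by
    obtain ⟨k', hk', hsep, hmin⟩ :=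
      hLF.exists_closest (fun z => r k z) m₁ k (hr.equiv.refl k)
    have hlt : Q.lt m₁ k' := by
      refine mk.2.2 m₁ k' hm₁ hk' ?_
      rintro z (hz | hz | hz) hs
      · refine hcloseK z hz ?_
        rcases hsep with rfl | hsep
        · exact hs
        · exact Q.separates_symm (Q.separates_trans hsep (Q.separates_symm hs))
      · exact hmin z hz (Q.separates_symm hs)
      · exact hmin _ hz (Q.separates_star_left.2 (Q.separates_symm hs))
    have hin : Q.Inside k' (Q.star m₁) := Or.inr (Q.star_lt_star hlt)
    rcases hsep with rfl | hsep
    · exact hin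
    · exact Q.inside_of_separates (Q.separates_star_right.2 hsep) hin
  exact hno m₁ (Or.inl hm₁) (Q.separates_iff.2 (Or.inl ⟨hh, hk⟩))

theorem exists_separates_of_quotSeparates (hLF : Q.LocallyFinite) {r : P → P → Prop}
    (hr : Q.IsStarEquiv r) {m h k : P} (hs : Q.QuotSeparates r m h k) :
    ∃ m', Q.hypRel r m m' ∧ Q.separates m' h k := by
  obtain ⟨a, ha, b, hb, c, hc, h1, h2⟩ := hs
  obtain ⟨m', hm', hs⟩ := exists_separates_of_quotLT hLF hr h1 h2
  refine ⟨m', hr.hypRel_trans ?_ hm', ?_⟩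
  · exact hr.hypRel_of_sameHyp hb
  · rcases ha with rfl | rfl <;> rcases hc with rfl | rfl <;>
      simpa only [Q.separates_star_mid, Q.separates_star_right] using hs

/-- A star-invariant equivalence relation `r` refining `s`, each of whose classes contains all
`s`-equivalent hyperplanes separating two of its members. -/
structure IsConvexRefinement (Q : Pocset P) (s r : P → P → Prop) : Prop
    extends Q.IsStarEquiv r where
  refines : ∀ a b, r a b → s a b
  convex : ∀ a b m, r a b → Q.hypRel s a m → Q.separates m a b → Q.hypRel r a m

section Admissible

variable {s r : P → P → Prop} (hs : Q.IsAdmissible s)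
include hs

theorem IsAdmissible.nested {a b : P} (h : Q.hypRel s a b) (h' : ¬ Q.sameHyp a b) :
    Q.Nested a b := by
  refine disjointHyp.nested ⟨h', fun ht => ?_⟩
  rcases h with h | h
  · exact hs.aer3 _ _ ht h
  · refine hs.aer3 a (Q.star b) ⟨?_, ?_⟩ h
    · intro h1
      refine ht.1 ?_
      unfold sameHyp at *
      have := Q.star_star
      grind
    · intro x hx y hy
      refine ht.2 x hx y ?_
      simp only [orient, Set.mem_insert_iff, Set.mem_singleton_iff, Q.star_star] at hy ⊢
      exact hy.symm

theorem IsAdmissible.not_rel_star {a b : P} (h : s a b) : ¬ s a (Q.star b) := fun h' =>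
  hs.aer1 b (hs.equiv.trans (hs.equiv.symm h) h')

theorem IsConvexRefinement.rel_of_hypRel (hr : Q.IsConvexRefinement s r) {a b : P}
    (h : s a b) (h' : Q.hypRel r a b) : r a b :=
  h'.resolve_right fun hstar => hs.not_rel_star h (hr.refines _ _ hstar)

/-- Inseparable equivalent halfspaces face each other or face away from each other. -/
theorem IsAdmissible.facing_or {a b : P} (h : s a b) (hab : ¬ Q.sameHyp a b)
    (hi : ∀ m, Q.hypRel s a m → ¬ Q.separates m a b) :
    Q.facing a b ∨ Q.facing (Q.star a) (Q.star b) := by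
  have h4 := hs.aer4 a b (Or.inl h) hab hi
  have hn := hs.nested (Or.inl h) hab
  have e := hs.not_rel_star h
  have e' : ¬ s (Q.star a) b := fun h' => e (by simpa [Q.star_star] using hs.aer2 _ _ h')
  have h5 := h4 a (Or.inl rfl) (Q.star b) (Or.inr rfl)
  have h6 := h4 (Q.star a) (Or.inr rfl) b (Or.inl rfl)
  unfold facing Nested Inside at *
  have := Q.star_star
  have := @star_lt_star _ Q
  grind

/-- In a convex refinement, a hyperplane separates no class member from `a` if it is disjoint from
a member of another class adjacent to `a` and separates no two nearest members. -/
theorem IsConvexRefinement.inseparable_left (hr : Q.IsConvexRefinement s r) {a b a₁ b₁ : P}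
    (hab : s a b) (hi : ∀ m, Q.hypRel s a m → ¬ Q.separates m a b) (hrab : ¬ r a b)
    (ha₁ : r a a₁) (hb₁ : r b b₁)
    (hi₁ : ∀ m, Q.hypRel r a m ∨ Q.hypRel r b m → ¬ Q.separates m a₁ b₁) :
    ∀ m, Q.hypRel s a m → ¬ Q.separates m a a₁ := by
  intro m hm hsep
  have S := hs.isStarEquiv
  have R := hr.toIsStarEquiv
  have ham : Q.hypRel r a m := hr.convex a a₁ m ha₁ hm hsep
  have hrab' : ¬ Q.hypRel r a b := fun h => hrab (hr.rel_of_hypRel hs hab h)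
  have hbm : ¬ Q.hypRel r b m := fun h => hrab' (R.hypRel_trans ham (R.hypRel_symm h))
  have hsbm : Q.hypRel s b m := S.hypRel_trans (S.hypRel_symm (Or.inl hab)) hm
  have hn : Q.Nested b m := hs.nested hsbm fun h => hbm (R.hypRel_of_sameHyp h)
  have hn₁ : Q.Nested b₁ m := by
    refine hs.nested (S.hypRel_trans (S.hypRel_symm (Or.inl (hr.refines _ _ hb₁))) hsbm) ?_
    exact fun h => hbm (R.hypRel_trans (Or.inl hb₁) (R.hypRel_of_sameHyp h))
  rcases Q.separates_split hsep hn₁ with h | h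
  · rcases Q.separates_split h hn with h | h
    · exact hi m hm h
    · exact hbm (hr.convex b b₁ m hb₁ hsbm h)
  · exact hi₁ m (Or.inl ham) (Q.separates_symm h)

/-- If `a` faces `b` and does not separate `a₁` from `b`, then `a` also faces an inseparable
equivalent halfspace `a₁`. -/
theorem IsAdmissible.eq_or_facing {a b a₁ : P} (ha₁ : s a a₁) (hf : Q.facing a b)
    (hi : ∀ m, Q.hypRel s a m → ¬ Q.separates m a a₁) (hn : ¬ Q.separates a a₁ b) :
    a₁ = a ∨ Q.facing a a₁ := by
  by_cases e : Q.sameHyp a a₁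
  · refine Or.inl (e.resolve_right ?_)
    rintro rfl
    exact hs.aer1 _ ha₁
  · refine Or.inr ((hs.facing_or ha₁ e hi).resolve_right fun h => hn ?_)
    rw [separates_iff]
    exact Or.inr ⟨Or.inl (by simpa [facing, Q.star_star] using Q.star_lt_star h),
      Or.inr (by simpa [facing, Q.star_star] using Q.star_lt_star hf)⟩

/-- Facing inseparable `s`-equivalent halfspaces remain facing in a convex refinement. -/
theorem IsConvexRefinement.quotFacing (hr : Q.IsConvexRefinement s r) {a b : P}
    (hab : s a b) (hf : Q.facing a b) (hi : ∀ m, Q.hypRel s a m → ¬ Q.separates m a b)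
    (hrab : ¬ r a b) : Q.QuotFacing r a b := by
  have S := hs.isStarEquiv
  have R := hr.toIsStarEquiv
  have hrab' : ¬ Q.hypRel r a b := fun h => hrab (hr.rel_of_hypRel hs hab h)
  have star_left : ∀ x y, r (Q.star x) y → r x (Q.star y) := fun x y h => by
    simpa [Q.star_star] using hr.star _ _ h
  refine ⟨fun h => hrab' (Or.inr (star_left _ _ h)), ?_, ?_⟩
  · intro x y hx hy
    have hx' := star_left _ _ hx
    have hsxy : s (Q.star x) y :=
      hs.equiv.trans (hs.equiv.symm (hr.refines _ _ hx')) (hs.equiv.trans hab (hr.refines _ _ hy))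
    have hne : ¬ Q.sameHyp (Q.star x) y := fun h => hrab' <|
      R.hypRel_trans (R.hypRel_trans (Or.inl hx') (R.hypRel_of_sameHyp h))
        (R.hypRel_symm (Or.inl hy))
    have hne' : ¬ Q.sameHyp x y := by
      unfold sameHyp at *
      rw [Q.star_star] at hne
      tauto
    refine ⟨hne', fun ht => hs.aer3 x (Q.star y) ⟨?_, ?_⟩ ?_⟩
    · intro h
      refine hne' ?_
      unfold sameHyp at *
      have := Q.star_star
      grind
    · intro u hu v hv
      refine ht.2 u hu v ?_
      simp only [orient, Set.mem_insert_iff, Set.mem_singleton_iff, Q.star_star] at hv ⊢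
      exact hv.symm
    · simpa [Q.star_star] using hs.aer2 _ _ hsxy
  · intro x b₁ hx hb₁ hi₁
    have ha₁ := star_left _ _ hx
    obtain ⟨a₁, rfl⟩ : ∃ a₁, x = Q.star a₁ := ⟨Q.star x, (Q.star_star x).symm⟩
    rw [Q.star_star] at ha₁
    have hi₁' : ∀ m, Q.hypRel r a m ∨ Q.hypRel r b m → ¬ Q.separates m a₁ b₁ := by
      intro m hm hsep
      refine hi₁ m (hm.imp_left fun h => ?_) (Q.separates_star_mid.2 hsep)
      exact R.hypRel_trans (R.hypRel_symm (R.hypRel_of_sameHyp (Or.inr rfl))) h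
    have hba : s b a := hs.equiv.symm hab
    have sab : ∀ m, Q.hypRel s b m → Q.hypRel s a m := fun m => S.hypRel_trans (Or.inl hab)
    have hA := hr.inseparable_left hs hab hi hrab ha₁ hb₁ hi₁'
    have hB := hr.inseparable_left hs hba
      (fun m hm h => hi m (sab m hm) (Q.separates_symm h))
      (fun h => hrab (hr.equiv.symm h)) hb₁ ha₁
      (fun m hm h => hi₁' m hm.symm (Q.separates_symm h))
    have sa₁ := hr.refines _ _ ha₁
    have sb₁ := hr.refines _ _ hb₁
    have s₁ : s a₁ b₁ := hs.equiv.trans (hs.equiv.symm sa₁) (hs.equiv.trans hab sb₁)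
    have r₁ : ¬ Q.hypRel r a₁ b₁ := fun h => hrab' <|
      R.hypRel_trans (R.hypRel_trans (Or.inl ha₁) h) (R.hypRel_symm (Or.inl hb₁))
    have rba : ¬ Q.hypRel r b a := fun h => hrab' (R.hypRel_symm h)
    have nest : ∀ {u v w}, s u v → Q.hypRel s u w → ¬ Q.hypRel r v w → Q.Nested v w :=
      fun h h' h'' => hs.nested (S.hypRel_trans (S.hypRel_symm (Or.inl h)) h')
        fun e => h'' (R.hypRel_of_sameHyp e)
    have hab_ne : ¬ Q.separates a b b₁ := fun h =>
      rba (hr.convex b b₁ a hb₁ (Or.inl hba) h)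
    have hba_ne : ¬ Q.separates b a a₁ := fun h =>
      hrab' (hr.convex a a₁ b ha₁ (Or.inl hab) h)
    have hb₁a : Q.Nested b₁ a := nest sb₁ (Or.inl hba) fun h =>
      rba (R.hypRel_trans (Or.inl hb₁) h)
    have ha₁b : Q.Nested a₁ b := nest sa₁ (Or.inl hab) fun h =>
      hrab' (R.hypRel_trans (Or.inl ha₁) h)
    have fA : a₁ = a ∨ Q.facing a a₁ := by
      refine hs.eq_or_facing sa₁ hf hA fun hsep => ?_
      rcases Q.separates_split hsep hb₁a with h | h
      · exact hi₁' a (Or.inl (R.hypRel_refl a)) h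
      · exact hab_ne (Q.separates_symm h)
    have hf' : Q.facing b a := by simpa [facing, Q.star_star] using Q.star_lt_star hf
    have fB : b₁ = b ∨ Q.facing b b₁ := by
      refine hs.eq_or_facing sb₁ hf' hB fun hsep => ?_
      rcases Q.separates_split hsep ha₁b with h | h
      · exact hi₁' b (Or.inr (R.hypRel_refl b)) (Q.separates_symm h)
      · exact hba_ne (Q.separates_symm h)
    have hC : ∀ m, Q.hypRel s a₁ m → ¬ Q.separates m a₁ b₁ := by
      intro m hm hsep
      have ham : Q.hypRel s a m := S.hypRel_trans (Or.inl sa₁) hm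
      have hbm : Q.hypRel s b m := S.hypRel_trans (Or.inl hba) ham
      by_cases ea : Q.sameHyp a m
      · exact hi₁' m (Or.inl (R.hypRel_of_sameHyp ea)) hsep
      by_cases eb : Q.sameHyp b m
      · exact hi₁' m (Or.inr (R.hypRel_of_sameHyp eb)) hsep
      rcases Q.separates_split hsep (hs.nested ham ea) with h | h
      · exact hA m ham (Q.separates_symm h)
      rcases Q.separates_split h (hs.nested hbm eb) with h | h
      · exact hi m ham h
      · exact hB m hbm h
    refine (hs.facing_or s₁ (fun h => r₁ (R.hypRel_of_sameHyp h)) hC).resolve_right fun h => ?_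
    have hno := hi a₁ (Or.inl sa₁)
    have h₁ := @separates_of_lt _ Q (Q.star a) a₁ b
    rw [Q.separates_star_mid] at h₁
    have := Q.star_star
    have := @lt_trans _ Q
    have := @star_lt_star _ Q
    have := Q.not_lt_star
    have := Q.not_star_lt
    have := Q.not_lt_self
    unfold facing at *
    grind

variable {G : Type w} [Group G] [MulAction G P]

omit hs in
/-- The smallest invariant equivalence relation containing `r` and identifying `a` with `b`. -/
theorem exists_isFoldStepRel (a b : P) : ∃ r', Q.IsFoldStepRel G r a b r' := by
  refine ⟨fun x y => ∀ t : P → P → Prop, Equivalence t → (∀ a b, r a b → t a b) →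
    (∀ (g : G) (a b : P), t a b → t (g • a) (g • b)) →
    (∀ a b, t a b → t (Q.star a) (Q.star b)) → t a b → t x y, ?_, ?_, ?_, ?_, ?_, ?_⟩
  · exact ⟨fun x t h _ _ _ _ => h.refl x,
      fun hxy t h h1 h2 h3 h4 => h.symm (hxy t h h1 h2 h3 h4),
      fun hxy hyz t h h1 h2 h3 h4 => h.trans (hxy t h h1 h2 h3 h4) (hyz t h h1 h2 h3 h4)⟩
  · exact fun x y hxy t _ h1 _ _ _ => h1 x y hxy
  · exact fun g x y hxy t h h1 h2 h3 h4 => h2 g x y (hxy t h h1 h2 h3 h4)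
  · exact fun x y hxy t h h1 h2 h3 h4 => h3 x y (hxy t h h1 h2 h3 h4)
  · exact fun t _ _ _ _ h4 => h4
  · exact fun t h h1 h2 h3 h4 x y hxy => hxy t h h1 h2 h3 h4

omit hs in
theorem separates_smul (hG : Q.IsGAction G) (g : G) {m a b : P} (h : Q.separates m a b) :
    Q.separates (g • m) (g • a) (g • b) := by
  have key : ∀ {x y : P}, Q.lt x y → Q.lt (g • x) (g • y) := fun h =>
    ⟨hG.smul_le g _ _ h.1, fun e => h.2 (smul_left_cancel g e)⟩
  have ori : ∀ {x y : P}, x ∈ Q.orient y → g • x ∈ Q.orient (g • y) := by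
    rintro x y (rfl | rfl)
    · exact Or.inl rfl
    · exact Or.inr (hG.smul_star g y)
  obtain ⟨x, hx, y, hy, z, hz, h1, h2⟩ := h
  exact ⟨_, ori hx, _, ori hy, _, ori hz, key h1, key h2⟩

omit hs in
theorem hypRel_smul (hG : Q.IsGAction G) (hinv : ∀ (g : G) (a b : P), r a b → r (g • a) (g • b))
    (g : G) {a b : P} (h : Q.hypRel r a b) : Q.hypRel r (g • a) (g • b) := by
  refine h.imp (hinv g a b) fun h => ?_
  rw [← hG.smul_star]
  exact hinv g _ _ h

/-- Identifying an inseparable facing pair preserves convexity. -/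
theorem IsFoldStepRel.isConvexRefinement (hG : Q.IsGAction G)
    (hsG : ∀ (g : G) (a b : P), s a b → s (g • a) (g • b))
    (hr : Q.IsConvexRefinement s r) {a b : P} (hab : s a b)
    (hi : ∀ m, Q.hypRel s a m → ¬ Q.separates m a b) {r' : P → P → Prop}
    (hr' : Q.IsFoldStepRel G r a b r') : Q.IsConvexRefinement s r' := by
  have S := hs.isStarEquiv
  have R : Q.IsStarEquiv r' := ⟨hr'.equiv, hr'.sinv⟩
  have href : ∀ x y, r' x y → s x y := hr'.min s hs.equiv hr.refines hsG hs.aer2 hab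
  refine ⟨R, href, ?_⟩
  have key := hr'.min
    (fun x y => r' x y ∧ ∀ m, Q.hypRel s x m → Q.separates m x y → Q.hypRel r' x m)
    ⟨fun x => ⟨hr'.equiv.refl x, fun m _ h => absurd h Q.not_separates_self⟩, ?_, ?_⟩ ?_ ?_ ?_
    ⟨hr'.base, fun m hm h => absurd h (hi m hm)⟩
  · exact fun x y m h => (key x y h).2 m
  · rintro x y ⟨h, h'⟩
    refine ⟨hr'.equiv.symm h, fun m hm hsep => ?_⟩
    exact R.hypRel_trans (R.hypRel_symm (Or.inl h))
      (h' m (S.hypRel_trans (Or.inl (href _ _ h)) hm) (Q.separates_symm hsep))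
  · rintro x y z ⟨h, h'⟩ ⟨k, k'⟩
    refine ⟨hr'.equiv.trans h k, fun m hm hsep => ?_⟩
    have hym : Q.hypRel s y m := S.hypRel_trans (S.hypRel_symm (Or.inl (href _ _ h))) hm
    by_cases e : Q.sameHyp y m
    · exact R.hypRel_trans (Or.inl h) (R.hypRel_of_sameHyp e)
    rcases Q.separates_split hsep (hs.nested hym e) with h1 | h1
    · exact h' m hm h1
    · exact R.hypRel_trans (Or.inl h) (k' m hym h1)
  · exact fun x y h => ⟨hr'.mono x y h, fun m hm hsep =>
      (hr.convex x y m h hm hsep).imp (hr'.mono _ _) (hr'.mono _ _)⟩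
  · rintro g x y ⟨h, h'⟩
    refine ⟨hr'.ginv g x y h, fun m hm hsep => ?_⟩
    have h1 := hypRel_smul hG hsG g⁻¹ hm
    have h2 := separates_smul hG g⁻¹ hsep
    rw [inv_smul_smul] at h1 h2
    rw [inv_smul_smul] at h2
    simpa using hypRel_smul hG hr'.ginv g (h' _ h1 h2)
  · rintro x y ⟨h, h'⟩
    refine ⟨hr'.sinv x y h, fun m hm hsep => ?_⟩
    rw [Q.separates_star_mid, Q.separates_star_right] at hsep
    have e : Q.hypRel s x (Q.star x) := S.hypRel_of_sameHyp (Or.inr rfl)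
    have e' : Q.hypRel r' x (Q.star x) := R.hypRel_of_sameHyp (Or.inr rfl)
    exact R.hypRel_trans (R.hypRel_symm e') (h' m (S.hypRel_trans e hm) hsep)

/-- Between two equivalent but not yet identified hyperplanes there is an elementary foldable
pair. -/
theorem IsConvexRefinement.exists_foldable (hLF : Q.LocallyFinite)
    (hr : Q.IsConvexRefinement s r) {x y : P} (hxy : Q.lt x y) (hsxy : Q.hypRel s x y)
    (hrxy : ¬ Q.hypRel r x y) :
    ∃ a b, Q.le x a ∧ Q.le b y ∧ Q.lt a b ∧ ¬ Q.hypRel r a b ∧ s (Q.star a) b ∧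
      (∀ m, Q.hypRel s (Q.star a) m → ¬ Q.separates m (Q.star a) b) ∧
      Q.QuotFacing r (Q.star a) b ∧
      (∀ m, Q.hypRel s m (Q.star a) → ¬ Q.QuotSeparates r m (Q.star a) b) ∧
      ∀ m m', Q.hypRel s m m' → ¬ Q.hypRel r m m' →
        ¬ (Q.QuotSeparates r m (Q.star a) b ∧ Q.QuotSeparates r m' (Q.star a) b) := by
  have S := hs.isStarEquiv
  have R := hr.toIsStarEquiv
  obtain ⟨⟨a, b⟩, ⟨hxa, hby, hab, hsab, hrab⟩, hmin⟩ :=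
    (measure fun p : P × P => {c : P | Q.le p.1 c ∧ Q.le c p.2}.ncard).wf.has_min
      {p : P × P | Q.le x p.1 ∧ Q.le p.2 y ∧ Q.lt p.1 p.2 ∧ Q.hypRel s p.1 p.2 ∧
        ¬ Q.hypRel r p.1 p.2} ⟨(x, y), Q.le_refl x, Q.le_refl y, hxy, hsxy, hrxy⟩
  have no_smaller : ∀ c d, Q.le a c → Q.le d b → (c ≠ a ∨ d ≠ b) → Q.lt c d → Q.hypRel s c d →
      Q.hypRel r c d := by
    intro c d hac hdb hne hcd hs'
    by_contra hr'
    refine hmin (c, d) ⟨Q.le_trans hxa hac, Q.le_trans hdb hby, hcd, hs', hr'⟩ ?_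
    refine Set.ncard_lt_ncard ⟨fun z hz => ⟨Q.le_trans hac hz.1, Q.le_trans hz.2 hdb⟩,
      fun hsub => ?_⟩ (hLF a b)
    rcases hne with h | h
    · exact h (Q.le_antisymm (hsub ⟨Q.le_refl a, hab.1⟩).1 hac)
    · exact h (Q.le_antisymm hdb (hsub ⟨hab.1, Q.le_refl b⟩).2)
  have hi : ∀ m, Q.hypRel s a m → ¬ Q.separates m a b := by
    intro m hm hsep
    obtain ⟨z, hz, haz, hzb⟩ := Q.exists_between hab hsep
    have hmz : Q.hypRel s m z := S.hypRel_of_sameHyp hz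
    have haz' := S.hypRel_trans hm hmz
    refine hrab (R.hypRel_trans (b := z) ?_ ?_)
    · exact no_smaller a z (Q.le_refl a) hzb.1 (Or.inr hzb.2) haz haz'
    · exact no_smaller z b haz.1 (Q.le_refl b) (Or.inl haz.2.symm) hzb
        (S.hypRel_trans (S.hypRel_symm haz') hsab)
  have e : Q.hypRel s a (Q.star a) := S.hypRel_of_sameHyp (Or.inr rfl)
  have hne : ¬ Q.sameHyp a b := fun h => hrab (R.hypRel_of_sameHyp h)
  have hf : Q.facing (Q.star a) b := by unfold facing; rwa [Q.star_star]
  have hsab' : s (Q.star a) b :=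
    hs.aer4 a b hsab hne hi _ (Or.inr rfl) b (Or.inl rfl) hf
  have hi' : ∀ m, Q.hypRel s (Q.star a) m → ¬ Q.separates m (Q.star a) b := by
    intro m hm hsep
    exact hi m (S.hypRel_trans e hm) (Q.separates_star_mid.1 hsep)
  refine ⟨a, b, hxa, hby, hab, hrab, hsab', hi', ?_, ?_, ?_⟩
  · refine hr.quotFacing hs hsab' hf hi' fun h => hrab ?_
    exact R.hypRel_trans (R.hypRel_of_sameHyp (Or.inr rfl)) (Or.inl h)
  · intro m hm hsep
    obtain ⟨m', hm', hsep'⟩ := exists_separates_of_quotSeparates hLF R hsep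
    exact hi' m' (S.hypRel_trans (S.hypRel_symm hm)
      (hm'.imp (hr.refines _ _) (hr.refines _ _))) hsep'
  · rintro m m' hsm hrm ⟨h, h'⟩
    obtain ⟨u, hu, hsep⟩ := exists_separates_of_quotSeparates hLF R h
    obtain ⟨v, hv, hsep'⟩ := exists_separates_of_quotSeparates hLF R h'
    obtain ⟨u, hu', hau, hub⟩ := Q.exists_between hab (Q.separates_star_mid.1 hsep)
    obtain ⟨v, hv', hav, hvb⟩ := Q.exists_between hab (Q.separates_star_mid.1 hsep')
    replace hu := R.hypRel_trans hu (R.hypRel_of_sameHyp hu')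
    replace hv := R.hypRel_trans hv (R.hypRel_of_sameHyp hv')
    have toS : ∀ {p q}, Q.hypRel r p q → Q.hypRel s p q := fun h =>
      h.imp (hr.refines _ _) (hr.refines _ _)
    have huv : Q.hypRel s u v :=
      S.hypRel_trans (S.hypRel_symm (toS hu)) (S.hypRel_trans hsm (toS hv))
    have huv' : ¬ Q.hypRel r u v := fun h =>
      hrm (R.hypRel_trans hu (R.hypRel_trans h (R.hypRel_symm hv)))
    have hn := hs.nested huv fun h => huv' (R.hypRel_of_sameHyp h)
    have hcmp : Q.lt u v ∨ Q.lt v u := by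
      have := Q.star_star
      have := @lt_trans _ Q
      have := @star_lt_star _ Q
      have := Q.not_lt_star
      have := Q.not_star_lt
      unfold Nested Inside at hn
      grind
    rcases hcmp with hlt | hlt
    · exact huv' (no_smaller u v hau.1 hvb.1 (Or.inl hau.2.symm) hlt huv)
    · exact huv' (R.hypRel_symm
        (no_smaller v u hav.1 hub.1 (Or.inl hav.2.symm) hlt (S.hypRel_symm huv)))

end Admissible

end Relations

section Folding

variable {Q : Pocset P} {Q' : Pocset P'} {f : P → P'}
  {G : Type w} [Group G] [MulAction G P]

/-- Relations obtained from equality by finitely many elementary folds. -/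
structure Reachable (Q : Pocset P) (Q' : Pocset P') (G : Type w) [Group G] [MulAction G P]
    (f : P → P') (r : P → P → Prop) : Prop where
  convexRefinement : Q.IsConvexRefinement (simRel f) r
  smul : ∀ (g : G) (a b : P), r a b → r (g • a) (g • b)
  sequence : ∃ (n : ℕ) (rs : Fin (n + 1) → (P → P → Prop)),
    IsFoldingSequence Q Q' G f n rs ∧ rs (Fin.last n) = r

theorem reachable_eq : Reachable Q Q' G f Eq where
  convexRefinement :=
    { equiv := eq_equivalence
      star := fun _ _ h => congrArg _ h
      refines := fun _ _ h => congrArg f h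
      convex := by
        rintro a _ m rfl _ h
        exact absurd h Q.not_separates_self }
  smul := fun g _ _ h => congrArg (g • ·) h
  sequence := ⟨0, fun _ => Eq, ⟨fun _ _ => Iff.rfl, fun _ _ _ h => congrArg f h,
    fun i => i.elim0⟩, rfl⟩

theorem sameHyp_map_iff (hf : ∀ h, f (Q.star h) = Q'.star (f h)) {a b : P} :
    Q'.sameHyp (f a) (f b) ↔ Q.hypRel (simRel f) b a := by
  unfold sameHyp hypRel simRel
  rw [hf]

theorem Reachable.fold {r r' : P → P → Prop} (hr : Reachable Q Q' G f r) {a b : P}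
    (hab : Q.QuotElemFoldable Q' f r a b) (hr' : Q.IsFoldStepRel G r a b r')
    (hc : Q.IsConvexRefinement (simRel f) r') : Reachable Q Q' G f r' := by
  refine ⟨hc, hr'.ginv, ?_⟩
  obtain ⟨n, rs, ⟨h0, h1, h2⟩, rfl⟩ := hr.sequence
  refine ⟨n + 1, Fin.snoc rs r', ⟨?_, ?_, ?_⟩, Fin.snoc_last _ _⟩
  · intro x y
    rw [show (0 : Fin (n + 1 + 1)) = Fin.castSucc 0 from rfl, Fin.snoc_castSucc]
    exact h0 x y
  · intro i
    refine Fin.lastCases ?_ (fun i => ?_) i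
    · rw [Fin.snoc_last]
      exact hc.refines
    · rw [Fin.snoc_castSucc]
      exact h1 i
  · intro i
    refine Fin.lastCases ?_ (fun i => ?_) i
    · rw [Fin.succ_last, Fin.snoc_last, Fin.snoc_castSucc]
      exact ⟨a, b, hab, hr'⟩
    · rw [Fin.succ_castSucc, Fin.snoc_castSucc, Fin.snoc_castSucc]
      exact h2 i

/-- An invariant equivalence relation identifies `c` with its translates under a subgroup as
soon as it does so for generators. -/
theorem rel_smul_of_mem_closure {r : P → P → Prop} (hr : Equivalence r)
    (hinv : ∀ (g : G) (a b : P), r a b → r (g • a) (g • b)) {c : P} {S : Set G}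
    (hS : ∀ g ∈ S, r c (g • c)) {g : G} (hg : g ∈ Subgroup.closure S) : r c (g • c) := by
  induction hg using Subgroup.closure_induction with
  | mem g hg => exact hS g hg
  | one => rw [one_smul]; exact hr.refl c
  | mul x y _ _ hx hy => rw [mul_smul]; exact hr.trans hx (hinv x _ _ hy)
  | inv x _ hx =>
    have := hinv x⁻¹ _ _ hx
    rw [inv_smul_smul] at this
    exact hr.symm this

variable [MulAction G P'] {x y : P}

/-- Finitely many folds identify two comparable hyperplanes with the same image. -/
theorem Reachable.exists_hypRel (hLF : Q.LocallyFinite) (hG : Q.IsGAction G)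
    (hres : IsResolution Q Q' f) (hequi : Equivariant G f) (hxy : Q.lt x y)
    (hsxy : Q.hypRel (simRel f) x y) {r : P → P → Prop} (hr : Reachable Q Q' G f r) :
    ∃ r', Reachable Q Q' G f r' ∧ (∀ a b, r a b → r' a b) ∧ Q.hypRel r' x y := by
  have hs := hres.aer
  have S := hs.isStarEquiv
  have hsG : ∀ (g : G) (a b : P), simRel f a b → simRel f (g • a) (g • b) := by
    intro g a b h
    change f (g • a) = f (g • b)
    rw [hequi, hequi, h]
  induction hn : {p : P × P | p ∈ {c : P | Q.le x c ∧ Q.le c y} ×ˢ {c : P | Q.le x c ∧ Q.le c y} ∧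
      ¬ Q.hypRel r p.1 p.2}.ncard using Nat.strong_induction_on generalizing r with
  | _ n ih =>
    by_cases hrxy : Q.hypRel r x y
    · exact ⟨r, hr, fun _ _ h => h, hrxy⟩
    obtain ⟨a, b, hxa, hby, hab, hrab, hsab, hi, hq, hq', hq''⟩ :=
      hr.convexRefinement.exists_foldable hs hLF hxy hsxy hrxy
    obtain ⟨r', hr'⟩ := exists_isFoldStepRel (Q := Q) (r := r) (G := G) (Q.star a) b
    have hc := hr'.isConvexRefinement hs hG hsG hr.convexRefinement hsab hi
    have hR : Reachable Q Q' G f r' := by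
      refine hr.fold ⟨hq, hsab, ?_, ?_⟩ hr' hc
      · intro m hm
        exact hq' m (S.hypRel_symm ((sameHyp_map_iff hres.adm.am1).1 hm))
      · intro m m' hm
        exact hq'' m m' (S.hypRel_symm ((sameHyp_map_iff hres.adm.am1).1 hm))
    obtain ⟨r'', h1, h2, h3⟩ := ih _ (by
      rw [← hn]
      refine Set.ncard_lt_ncard ⟨fun p hp => ⟨hp.1, fun h => hp.2 ?_⟩, fun hsub => ?_⟩
        (((hLF x y).prod (hLF x y)).subset fun p hp => hp.1)
      · exact h.imp (hr'.mono _ _) (hr'.mono _ _)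
      · refine (hsub (a := (a, b)) ⟨⟨⟨hxa, ?_⟩, ⟨?_, hby⟩⟩, hrab⟩).2 ?_
        · exact Q.le_trans hab.1 hby
        · exact Q.le_trans hxa hab.1
        · exact hc.hypRel_trans (hc.hypRel_of_sameHyp (Or.inr rfl)) (Or.inl hr'.base)) hR rfl
    exact ⟨r'', h1, fun u v h => h2 u v (hr'.mono u v h), h3⟩

/-- Finitely many folds identify two halfspaces with the same image. -/
theorem Reachable.exists_rel (hLF : Q.LocallyFinite) (hG : Q.IsGAction G)
    (hres : IsResolution Q Q' f) (hequi : Equivariant G f) (hxy : f x = f y)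
    {r : P → P → Prop} (hr : Reachable Q Q' G f r) :
    ∃ r', Reachable Q Q' G f r' ∧ (∀ a b, r a b → r' a b) ∧ r' x y := by
  have hs := hres.aer
  have S := hs.isStarEquiv
  by_cases hne : Q.sameHyp x y
  · refine ⟨r, hr, fun _ _ h => h, ?_⟩
    rcases hne with rfl | rfl
    · exact hr.convexRefinement.equiv.refl _
    · exact absurd hxy (hs.aer1 x)
  obtain ⟨u, hu, v, hv, huv⟩ : ∃ u ∈ Q.orient x, ∃ v ∈ Q.orient y, Q.lt u v := by
    rcases hs.nested (Or.inl hxy) hne with (h | h) | (h | h)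
    · exact ⟨_, Or.inl rfl, _, Or.inl rfl, h⟩
    · exact ⟨_, Or.inr rfl, _, Or.inl rfl, h⟩
    · exact ⟨_, Or.inl rfl, _, Or.inr rfl, h⟩
    · exact ⟨_, Or.inr rfl, _, Or.inr rfl, h⟩
  obtain ⟨r', h1, h2, h3⟩ := hr.exists_hypRel hLF hG hres hequi huv
    (S.hypRel_trans (S.hypRel_symm (S.hypRel_of_sameHyp hu))
      (S.hypRel_trans (Or.inl hxy) (S.hypRel_of_sameHyp hv)))
  have R := h1.convexRefinement.toIsStarEquiv
  refine ⟨r', h1, h2, h1.convexRefinement.rel_of_hypRel hs hxy ?_⟩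
  exact R.hypRel_trans (R.hypRel_of_sameHyp hu)
    (R.hypRel_trans h3 (R.hypRel_symm (R.hypRel_of_sameHyp hv)))

theorem exists_reachable_of_finite (hLF : Q.LocallyFinite) (hG : Q.IsGAction G)
    (hres : IsResolution Q Q' f) (hequi : Equivariant G f) {T : Set (P × P)} (hT : T.Finite)
    (hTf : ∀ p ∈ T, f p.1 = f p.2) :
    ∃ r, Reachable Q Q' G f r ∧ ∀ p ∈ T, r p.1 p.2 := by
  induction T, hT using Set.Finite.induction_on with
  | empty => exact ⟨Eq, reachable_eq, by simp⟩
  | @insert p T _ _ ih =>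
    obtain ⟨r, hr, h⟩ := ih fun q hq => hTf q (Or.inr hq)
    obtain ⟨r', hr', h1, h2⟩ := hr.exists_rel hLF hG hres hequi (hTf p (Or.inl rfl))
    refine ⟨r', hr', ?_⟩
    rintro q (rfl | hq)
    · exact h2
    · exact h1 _ _ (h q hq)

/-- Finitely many pairs generate the relation induced by `f` as an invariant equivalence
relation. -/
theorem exists_finite_generating (hequi : Equivariant G f)
    (horb : ∃ s : Finset P, ∀ a : P, ∃ g : G, g • a ∈ s)
    (hstab : ∀ h' : P', ∃ S : Finset G,
      (∀ g ∈ S, g • h' = h') ∧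
      ∀ g : G, g • h' = h' → g ∈ Subgroup.closure (S : Set G)) :
    ∃ T : Set (P × P), T.Finite ∧ (∀ p ∈ T, f p.1 = f p.2) ∧
      ∀ r : P → P → Prop, Equivalence r →
        (∀ (g : G) (a b : P), r a b → r (g • a) (g • b)) → (∀ p ∈ T, r p.1 p.2) →
        ∀ a b, f a = f b → r a b := by
  classical
  obtain ⟨s, hs⟩ := horb
  choose S hS hS' using hstab
  have hk : ∀ p : P × P, ∃ k : G, (∃ g : G, f (g • p.2) = f p.1) → f (k • p.2) = f p.1 := by
    intro p
    by_cases h : ∃ g : G, f (g • p.2) = f p.1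
    · exact ⟨h.choose, fun _ => h.choose_spec⟩
    · exact ⟨1, fun h' => absurd h' h⟩
  choose k hk using hk
  refine ⟨{p | (∃ c ∈ s, ∃ g ∈ S (f c), p = (c, g • c)) ∨
    ((∃ c ∈ s, ∃ d ∈ s, p = (c, k (c, d) • d)) ∧ f p.1 = f p.2)}, ?_, ?_, ?_⟩
  · refine Set.Finite.subset (s := ⋃ c ∈ s, ((⋃ g ∈ S (f c), {(c, g • c)}) ∪
      ⋃ d ∈ s, {(c, k (c, d) • d)})) ?_ ?_
    · exact s.finite_toSet.biUnion fun c _ =>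
        ((S (f c)).finite_toSet.biUnion fun _ _ => Set.finite_singleton _).union
          (s.finite_toSet.biUnion fun _ _ => Set.finite_singleton _)
    · rintro p (⟨c, hc, g, hg, rfl⟩ | ⟨⟨c, hc, d, hd, rfl⟩, -⟩)
      · simp only [Set.mem_iUnion]
        refine ⟨c, hc, Or.inl ?_⟩
        simp only [Set.mem_iUnion]
        exact ⟨g, hg, rfl⟩
      · simp only [Set.mem_iUnion]
        refine ⟨c, hc, Or.inr ?_⟩
        simp only [Set.mem_iUnion]
        exact ⟨d, hd, rfl⟩
  · rintro p (⟨c, hc, g, hg, rfl⟩ | ⟨-, h⟩)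
    · change f c = f (g • c)
      rw [hequi, hS (f c) g hg]
    · exact h
  · intro r hr hinv hT a b hab
    obtain ⟨x, hx⟩ := hs a
    obtain ⟨y, hy⟩ := hs b
    set c := x • a with hc
    set d := y • b with hd
    have hxb : f ((x * y⁻¹) • d) = f c := by
      rw [hd, smul_smul, inv_mul_cancel_right, hequi, ← hab, hc, hequi]
    have hkd := hk (c, d) ⟨_, hxb⟩
    set t := k (c, d)
    have h1 : r c (t • d) := hT (c, t • d) (Or.inr ⟨⟨c, hx, d, hy, rfl⟩, hkd.symm⟩)
    have hz : (x * y⁻¹ * t⁻¹) • f c = f c := by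
      rw [← hkd, ← hequi, smul_smul, inv_mul_cancel_right, hxb, hkd]
    have h2 : r c ((x * y⁻¹ * t⁻¹) • c) :=
      rel_smul_of_mem_closure hr hinv
        (fun g hg => hT (c, g • c) (Or.inl ⟨c, hx, g, hg, rfl⟩)) (hS' (f c) _ hz)
    have h3 := hr.trans h2 (hinv (x * y⁻¹ * t⁻¹) _ _ h1)
    rw [smul_smul, inv_mul_cancel_right, hd, smul_smul, inv_mul_cancel_right, hc] at h3
    simpa using hinv x⁻¹ _ _ h3

end Folding

end Pocset

/-- if `G` has finitely many orbits on `P` and all hyperplane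
stabilizers in `P'` are finitely generated, then there is a finite folding
sequence for `f` whose final pocset is `P/∼_f` (i.e. the final relation is
exactly `∼_f`), so that the induced map to `P'` is an embedding of pocsets
and `f` factors through the folds followed by this embedding. -/
theorem finite_folding_sequence_exists {P : Type u} {P' : Type v}
    (Q : Pocset P) (Q' : Pocset P')
    (hLF : Q.LocallyFinite) (hLF' : Q'.LocallyFinite)
    (G : Type w) [Group G] [MulAction G P] [MulAction G P']
    (hG : Q.IsGAction G) (hG' : Q'.IsGAction G)
    (f : P → P') (hres : Pocset.IsResolution Q Q' f)
    (hequi : Pocset.Equivariant G f)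
    (horb : ∃ s : Finset P, ∀ a : P, ∃ g : G, g • a ∈ s)
    (hstab : ∀ h' : P', ∃ S : Finset G,
      (∀ g ∈ S, g • h' = h') ∧
      ∀ g : G, g • h' = h' → g ∈ Subgroup.closure (S : Set G)) :
    ∃ (n : ℕ) (rs : Fin (n + 1) → (P → P → Prop)),
      Pocset.IsFoldingSequence Q Q' G f n rs ∧
      (∀ a b : P, rs (Fin.last n) a b ↔ f a = f b) := by
  obtain ⟨T, hT, hTf, hgen⟩ := Pocset.exists_finite_generating hequi horb hstab
  obtain ⟨r, hr, hrT⟩ := Pocset.exists_reachable_of_finite hLF hG hres hequi hT hTf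
  obtain ⟨n, rs, hrs, rfl⟩ := hr.sequence
  exact ⟨n, rs, hrs, fun a b => ⟨hr.convexRefinement.refines a b,
    hgen _ hr.convexRefinement.equiv hr.smul hrT a b⟩⟩
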